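/- arXiv:2010.03691 — 5 statements merged into one kernel-verified Lean document; each statement's English description precedes it below -/
import Mathlib

section
/- Let S and A be finite sets, let Ω : (A → ℝ) → ℝ be strictly convex on the probability simplex over A and differentiable at every probability vector, let π, π_E : S → (probability vectors on A) be two policies, and let w : S → ℝ with w(s) ≥ 0 for all s. Then Σ_s w(s)·( Σ_a π(a|s)·t(a; π_E(·|s)) − Ω(π(·|s)) ) = −Σ_s w(s)·D_Ω(π(·|s) ‖ π_E(·|s)) ≤ 0, and equality with 0 holds if and only if π(·|s) = π_E(·|s) for every s with w(s) > 0. -/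
theorem ConvexOn.fderiv_sub_le_sub {E : Type*} [NormedAddCommGroup E] [NormedSpace ℝ E]
    {s : Set E} {f : E → ℝ} (hf : ConvexOn ℝ s f) {x y : E} (hx : x ∈ s) (hy : y ∈ s)
    (hd : DifferentiableAt ℝ f x) : fderiv ℝ f x (y - x) ≤ f y - f x := by
  have hc := hf.comp_affineMap (AffineMap.lineMap x y : ℝ →ᵃ[ℝ] E)
  have hderiv : HasDerivAt (f ∘ (AffineMap.lineMap x y : ℝ →ᵃ[ℝ] E))
      (fderiv ℝ f x (y - x)) 0 :=
    HasFDerivAt.comp_hasDerivAt (0 : ℝ) (by simpa using hd.hasFDerivAt)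
      AffineMap.hasDerivAt_lineMap
  have h := hc.le_slope_of_hasDerivAt (x := 0) (y := 1)
    (by simpa using hx) (by simpa using hy) one_pos hderiv
  simpa [slope_def_field] using h

theorem StrictConvexOn.fderiv_sub_lt_sub {E : Type*} [NormedAddCommGroup E] [NormedSpace ℝ E]
    {s : Set E} {f : E → ℝ} (hf : StrictConvexOn ℝ s f) {x y : E} (hx : x ∈ s) (hy : y ∈ s)
    (hxy : x ≠ y) (hd : DifferentiableAt ℝ f x) : fderiv ℝ f x (y - x) < f y - f x := by
  have hmid := hf.2 hx hy hxy one_half_pos one_half_pos (add_halves 1)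
  have hmem := hf.1 hx hy one_half_pos.le one_half_pos.le (add_halves 1)
  have hle := hf.convexOn.fderiv_sub_le_sub hx hmem hd
  have heq : (1 / 2 : ℝ) • x + (1 / 2 : ℝ) • y - x = (1 / 2 : ℝ) • (y - x) := by module
  rw [heq, map_smul] at hle
  simp only [smul_eq_mul] at hmid hle
  linarith


/-- For finite `S`, `A`, a regularizer `Ω` strictly convex on the
probability simplex and differentiable at every probability vector with gradient
`g p`, two policies `π`, `π_E` and nonnegative weights `w`, the weighted regularized
objective with reward `t(a; π_E(·|s))` equals the negative weighted sum of Bregman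
divergences, is `≤ 0`, and vanishes iff `π(·|s) = π_E(·|s)` wherever `w s > 0`. -/
theorem weighted_objective_eq_neg_bregman_and_nonpos
    {S A : Type*} [Fintype S] [Fintype A]
    (Ω : (A → ℝ) → ℝ) (g : (A → ℝ) → A → ℝ)
    (π πE : S → A → ℝ) (w : S → ℝ)
    (hconv : StrictConvexOn ℝ {p : A → ℝ | (∀ a, 0 ≤ p a) ∧ ∑ a, p a = 1} Ω)
    (hdiff : ∀ p : A → ℝ, (∀ a, 0 ≤ p a) → ∑ a, p a = 1 → DifferentiableAt ℝ Ω p)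
    (hgrad : ∀ p : A → ℝ, (∀ a, 0 ≤ p a) → ∑ a, p a = 1 →
      ∀ v : A → ℝ, fderiv ℝ Ω p v = ∑ a, v a * g p a)
    (hπ : ∀ s, (∀ a, 0 ≤ π s a) ∧ ∑ a, π s a = 1)
    (hπE : ∀ s, (∀ a, 0 ≤ πE s a) ∧ ∑ a, πE s a = 1)
    (hw : ∀ s, 0 ≤ w s) :
    (∑ s, w s * ((∑ a, π s a *
          (g (πE s) a - (∑ a', πE s a' * g (πE s) a') + Ω (πE s))) - Ω (π s))
        = -∑ s, w s * (Ω (π s) - Ω (πE s) - ∑ a, g (πE s) a * (π s a - πE s a)))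
    ∧ (∑ s, w s * ((∑ a, π s a *
          (g (πE s) a - (∑ a', πE s a' * g (πE s) a') + Ω (πE s))) - Ω (π s)) ≤ 0)
    ∧ ((∑ s, w s * ((∑ a, π s a *
          (g (πE s) a - (∑ a', πE s a' * g (πE s) a') + Ω (πE s))) - Ω (π s))) = 0
        ↔ ∀ s, 0 < w s → π s = πE s) := by
  have hobj : ∀ s, (∑ a, π s a *
      (g (πE s) a - (∑ a', πE s a' * g (πE s) a') + Ω (πE s))) - Ω (π s)
        = -(Ω (π s) - Ω (πE s) - ∑ a, g (πE s) a * (π s a - πE s a)) := by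
    intro s
    simp only [mul_add, mul_sub, sub_mul, Finset.sum_add_distrib, Finset.sum_sub_distrib,
      ← Finset.sum_mul, (hπ s).2, mul_comm (g (πE s) _)]
    ring
  have hbreg : ∀ s, Ω (π s) - Ω (πE s) - ∑ a, g (πE s) a * (π s a - πE s a)
      = Ω (π s) - Ω (πE s) - fderiv ℝ Ω (πE s) (π s - πE s) := by
    intro s
    rw [hgrad _ (hπE s).1 (hπE s).2]
    simp only [Pi.sub_apply, mul_comm]
  have hd s := hdiff _ (hπE s).1 (hπE s).2
  have hnonneg : ∀ s, 0 ≤ Ω (π s) - Ω (πE s) - fderiv ℝ Ω (πE s) (π s - πE s) := fun s ↦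
    sub_nonneg.2 (hconv.convexOn.fderiv_sub_le_sub (hπE s) (hπ s) (hd s))
  have hzero : ∀ s, Ω (π s) - Ω (πE s) - fderiv ℝ Ω (πE s) (π s - πE s) = 0
      ↔ π s = πE s := by
    refine fun s ↦ ⟨fun h ↦ ?_, fun h ↦ by simp [h]⟩
    by_contra hne
    exact (sub_pos.2 (hconv.fderiv_sub_lt_sub (hπE s) (hπ s) (Ne.symm hne) (hd s))).ne' h
  have hterm s := mul_nonneg (hw s) (hnonneg s)
  simp only [hobj, hbreg, mul_neg, Finset.sum_neg_distrib, neg_nonpos, neg_eq_zero, true_and]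
  refine ⟨Finset.sum_nonneg fun s _ ↦ hterm s, ?_⟩
  rw [Finset.sum_eq_zero_iff_of_nonneg fun s _ ↦ hterm s]
  simp only [Finset.mem_univ, true_imp_iff, mul_eq_zero, hzero, (hw _).lt_iff_ne']
  exact forall_congr' fun s ↦ or_iff_not_imp_left
end

section
/- Let S and A be finite sets, γ ∈ [0, 1), P₀ a probability vector on S, and P : S × A → (probability vectors on S). Let D be the set of flow-feasible d : S × A → ℝ (nonnegative, satisfying Σ_a d(s', a) = (1 − γ)·P₀(s') + γ·Σ_{s,a} P(s' | s, a)·d(s, a) for all s'). Let r : S × A → ℝ, Φ : S → ℝ, and define the shaped reward r̃(s, a) := r(s, a) + γ·Σ_{s'} P(s' | s, a)·Φ(s') − Φ(s). Then for any function Ω̄ : (S × A → ℝ) → ℝ and any d ∈ D, Σ_{s,a} r̃(s, a)·d(s, a) − Ω̄(d) = Σ_{s,a} r(s, a)·d(s, a) − Ω̄(d) − (1 − γ)·Σ_s P₀(s)·Φ(s); consequently d* ∈ D maximizes d ↦ Σ_{s,a} r(s, a)·d(s, a) − Ω̄(d) over D if and only if d* maximizes d ↦ Σ_{s,a} r̃(s,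 a)·d(s, a) − Ω̄(d) over D. -/
/-- Pairing the flow constraint with a potential `Φ`. -/
theorem sum_potential_mul_of_flow {S A : Type*} [Fintype S] [Fintype A]
    {γ : ℝ} {P0 : S → ℝ} {P : S → A → S → ℝ} {d : S → A → ℝ}
    (hd : ∀ s' : S, ∑ a, d s' a = (1 - γ) * P0 s' + γ * ∑ s, ∑ a, P s a s' * d s a)
    (Φ : S → ℝ) :
    ∑ s, ∑ a, Φ s * d s a
      = (1 - γ) * ∑ s, P0 s * Φ s + γ * ∑ s, ∑ a, (∑ s', P s a s' * Φ s') * d s a := by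
  have hswap : ∑ s, ∑ a, (∑ s', P s a s' * Φ s') * d s a
      = ∑ s', Φ s' * ∑ s, ∑ a, P s a s' * d s a := by
    simp only [Finset.sum_mul, Finset.mul_sum]
    rw [Finset.sum_comm_cycle.symm.trans Finset.sum_comm_cycle.symm]
    exact Finset.sum_congr rfl fun s' _ => Finset.sum_congr rfl fun s _ =>
      Finset.sum_congr rfl fun a _ => by ring
  rw [hswap, Finset.mul_sum, Finset.mul_sum, ← Finset.sum_add_distrib]
  refine Finset.sum_congr rfl fun s _ => ?_
  rw [← Finset.mul_sum, hd s]
  ring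

/-- On flow-feasible `d`, shaping shifts the linear return by a constant. -/
theorem sum_shaped_reward_mul_of_flow {S A : Type*} [Fintype S] [Fintype A]
    {γ : ℝ} {P0 : S → ℝ} {P : S → A → S → ℝ} {d : S → A → ℝ}
    (hd : ∀ s' : S, ∑ a, d s' a = (1 - γ) * P0 s' + γ * ∑ s, ∑ a, P s a s' * d s a)
    (r : S → A → ℝ) (Φ : S → ℝ) :
    ∑ s, ∑ a, (r s a + γ * (∑ s', P s a s' * Φ s') - Φ s) * d s a
      = ∑ s, ∑ a, r s a * d s a - (1 - γ) * ∑ s, P0 s * Φ s := by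
  have h := sum_potential_mul_of_flow hd Φ
  simp only [sub_mul, add_mul, Finset.sum_sub_distrib, Finset.sum_add_distrib, mul_assoc,
    ← Finset.mul_sum] at h ⊢
  linarith

/-- Potential-based reward shaping. On the set `D` of flow-feasible
(nonnegative) occupancy measures, the shaped reward
`r̃(s,a) = r(s,a) + γ·∑_{s'} P(s'|s,a)·Φ(s') − Φ(s)` changes the regularized
objective `d ↦ ∑ r·d − Ω̄(d)` only by the constant `(1−γ)·∑_s P₀(s)·Φ(s)`;
consequently `d*` maximizes the original objective over `D` iff it maximizes the
shaped objective over `D`. -/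
theorem reward_shaping_preserves_maximizers
    {S A : Type*} [Fintype S] [Fintype A]
    (γ : ℝ) (hγ0 : 0 ≤ γ) (hγ1 : γ < 1)
    (P0 : S → ℝ) (hP0_nonneg : ∀ s, 0 ≤ P0 s) (hP0_sum : ∑ s, P0 s = 1)
    (P : S → A → S → ℝ)
    (hP_nonneg : ∀ s a s', 0 ≤ P s a s') (hP_sum : ∀ s a, ∑ s', P s a s' = 1)
    (r : S → A → ℝ) (Φ : S → ℝ)
    (Ωbar : (S → A → ℝ) → ℝ)
    (D : Set (S → A → ℝ))
    (hD : D = {d : S → A → ℝ | (∀ s a, 0 ≤ d s a) ∧ ∀ s' : S, ∑ a, d s' a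
      = (1 - γ) * P0 s' + γ * ∑ s, ∑ a, P s a s' * d s a}) :
    (∀ d ∈ D,
      (∑ s, ∑ a, (r s a + γ * (∑ s', P s a s' * Φ s') - Φ s) * d s a) - Ωbar d
        = (∑ s, ∑ a, r s a * d s a) - Ωbar d - (1 - γ) * ∑ s, P0 s * Φ s)
    ∧ (∀ dstar ∈ D,
      ((∀ d ∈ D, (∑ s, ∑ a, r s a * d s a) - Ωbar d
          ≤ (∑ s, ∑ a, r s a * dstar s a) - Ωbar dstar)
        ↔ (∀ d ∈ D,
          (∑ s, ∑ a, (r s a + γ * (∑ s', P s a s' * Φ s') - Φ s) * d s a) - Ωbar d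
            ≤ (∑ s, ∑ a, (r s a + γ * (∑ s', P s a s' * Φ s') - Φ s) * dstar s a)
              - Ωbar dstar))) := by
  subst hD
  refine ⟨fun d hd => ?_, fun dstar hstar => forall₂_congr fun d hd => ?_⟩
  · rw [sum_shaped_reward_mul_of_flow hd.2]
    ring
  · rw [sum_shaped_reward_mul_of_flow hd.2, sum_shaped_reward_mul_of_flow hstar.2]
    constructor <;> intro h <;> linarith
end

section
/- Let A be a finite set and Ω : (A → ℝ) → ℝ a function differentiable on the probability simplex. Define G on the set { x ∈ ℝ^A : x_a > 0 for all a } by G(x) := (Σ_a x_a)·Ω( x / Σ_a x_a ). Then G is differentiable and for every such x and every a ∈ A, writing π̄ := x / Σ_{a'} x_{a'}, the partial derivative satisfies ∂G/∂x_a (x) = [∇Ω(π̄)](a) − Σ_{a'} π̄(a')·[∇Ω(π̄)](a') + Ω(π̄) = t(a; π̄). -/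
/-- Derivative of the perspective-type function `y ↦ ℓ y * f ((ℓ y)⁻¹ • y)` along a continuous
linear functional `ℓ`. -/
theorem HasFDerivAt.mul_comp_inv_smul {E : Type*} [NormedAddCommGroup E] [NormedSpace ℝ E]
    {f : E → ℝ} {f' ℓ : E →L[ℝ] ℝ} {x : E} (hf : HasFDerivAt f f' ((ℓ x)⁻¹ • x))
    (hx : ℓ x ≠ 0) :
    HasFDerivAt (fun y => ℓ y * f ((ℓ y)⁻¹ • y))
      (f' + (f ((ℓ x)⁻¹ • x) - f' ((ℓ x)⁻¹ • x)) • ℓ) x := by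
  have hinv : HasFDerivAt (fun y => (ℓ y)⁻¹) (-((ℓ x) ^ 2)⁻¹ • ℓ) x :=
    (hasDerivAt_inv hx).comp_hasFDerivAt x ℓ.hasFDerivAt
  have hsmul := hinv.smul (hasFDerivAt_id x)
  have hcomp : HasFDerivAt (fun y => f ((ℓ y)⁻¹ • y)) _ x :=
    HasFDerivAt.comp (g := f) (f := fun y => (ℓ y)⁻¹ • y) x hf hsmul
  refine (ℓ.hasFDerivAt.mul hcomp).congr_fderiv ?_
  ext v
  simp
  field_simp
  ring


/-- For `Ω` differentiable on the probability simplex over a finite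
set `A`, define `G x := (∑ a, x a) * Ω (x / ∑ a, x a)` on the positive orthant. Then
`G` is differentiable at every positive `x` and its partial derivative in direction
`a` equals `t(a; π̄) = [∇Ω(π̄)](a) − ∑ a' π̄(a')·[∇Ω(π̄)](a') + Ω(π̄)`, where
`π̄ = x / ∑ a', x a'`. -/
theorem occupancy_regularizer_gradient
    {A : Type*} [Fintype A] [DecidableEq A]
    (Ω : (A → ℝ) → ℝ)
    (hΩ : ∀ p : A → ℝ, (∀ a, 0 ≤ p a) → ∑ a, p a = 1 → DifferentiableAt ℝ Ω p)
    (G : (A → ℝ) → ℝ)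
    (hG : G = fun x => (∑ a, x a) * Ω (fun a => x a / ∑ a', x a'))
    (x : A → ℝ) (hx : ∀ a, 0 < x a) :
    DifferentiableAt ℝ G x
    ∧ ∀ a, fderiv ℝ G x (Pi.single a 1)
        = fderiv ℝ Ω (fun b => x b / ∑ a', x a') (Pi.single a 1)
          - (∑ a', (x a' / ∑ b, x b) *
              fderiv ℝ Ω (fun b => x b / ∑ c, x c) (Pi.single a' 1))
          + Ω (fun b => x b / ∑ a', x a') := by
  let ℓ : (A → ℝ) →L[ℝ] ℝ := ∑ a, ContinuousLinearMap.proj a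
  have hℓ (y : A → ℝ) : ℓ y = ∑ a, y a := by simp [ℓ]
  have hdiv (y : A → ℝ) : (fun b => y b / ∑ a, y a) = (ℓ y)⁻¹ • y := by
    ext b
    simp [hℓ, div_eq_inv_mul]
  cases isEmpty_or_nonempty A with
  | inl _ => exact ⟨(hasFDerivAt_of_subsingleton G x).differentiableAt, isEmptyElim⟩
  | inr _ =>
    have hpos : 0 < ∑ a, x a := Finset.sum_pos (fun a _ => hx a) Finset.univ_nonempty
    have hd : DifferentiableAt ℝ Ω (fun b => x b / ∑ a, x a) :=
      hΩ _ (fun a => (div_pos (hx a) hpos).le) (by rw [← Finset.sum_div, div_self hpos.ne'])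
    have hsum : ∑ a', (x a' / ∑ b, x b) *
        fderiv ℝ Ω (fun b => x b / ∑ c, x c) (Pi.single a' 1)
        = fderiv ℝ Ω (fun b => x b / ∑ c, x c) (fun b => x b / ∑ c, x c) := by
      generalize fderiv ℝ Ω (fun b => x b / ∑ c, x c) = L
      conv_rhs => rw [pi_eq_sum_univ' (fun b => x b / ∑ c, x c)]
      simp
    have hG' : G = fun y => ℓ y * Ω ((ℓ y)⁻¹ • y) := by simp only [hG, hdiv, hℓ]
    rw [hdiv] at hd
    have hder := HasFDerivAt.mul_comp_inv_smul hd.hasFDerivAt (ne_of_eq_of_ne (hℓ x) hpos.ne')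
    rw [← hG'] at hder
    refine ⟨hder.differentiableAt, fun a => ?_⟩
    rw [hder.fderiv, hsum, hdiv]
    simp [hℓ]
    ring
end

section
/- Let X be a finite set, let d_E, d : X → ℝ with d_E(x) > 0 and d(x) > 0 for all x, and let t : X → ℝ be fixed. Let σ(z) := 1/(1 + e^{−z}) denote the logistic sigmoid. Then the function r ↦ Σ_x d_E(x)·log σ(r(x) − t(x)) + Σ_x d(x)·log(1 − σ(r(x) − t(x))), defined on all r : X → ℝ, attains its maximum uniquely at r̂(x) = t(x) + log( d_E(x) / d(x) ). -/
theorem sigmoid_log_div {a b : ℝ} (ha : 0 < a) (hb : 0 < b) :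
    Real.sigmoid (Real.log (a / b)) = a / (a + b) := by
  rw [Real.sigmoid_def, Real.exp_neg, Real.exp_log (div_pos ha hb)]
  field_simp

/-- Gibbs' inequality for two-point distributions, in strict form. -/
theorem mul_log_add_mul_log_one_sub_lt {a b s : ℝ} (ha : 0 < a) (hb : 0 < b)
    (hs : 0 < s) (hs' : s < 1) (hne : s ≠ a / (a + b)) :
    a * Real.log s + b * Real.log (1 - s) <
      a * Real.log (a / (a + b)) + b * Real.log (1 - a / (a + b)) := by
  have hab : 0 < a + b := add_pos ha hb
  have hp : 0 < a / (a + b) := div_pos ha hab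
  have hq : 1 - a / (a + b) = b / (a + b) := by field_simp; ring
  have hq' : 0 < b / (a + b) := div_pos hb hab
  have h1 := Real.log_lt_sub_one_of_pos (div_pos hs hp)
    (fun h => hne ((div_eq_one_iff_eq hp.ne').1 h))
  have h2 := Real.log_le_sub_one_of_pos (div_pos (sub_pos.2 hs') hq')
  rw [Real.log_div hs.ne' hp.ne'] at h1
  rw [Real.log_div (sub_pos.2 hs').ne' hq'.ne'] at h2
  have h3 := mul_lt_mul_of_pos_left h1 ha
  have h4 := mul_le_mul_of_nonneg_left h2 hb.le
  have h5 : a * (s / (a / (a + b)) - 1) + b * ((1 - s) / (b / (a + b)) - 1) = 0 := by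
    field_simp
    ring
  rw [hq]
  linarith

theorem mul_log_sigmoid_add_lt {a b z : ℝ} (ha : 0 < a) (hb : 0 < b)
    (hz : z ≠ Real.log (a / b)) :
    a * Real.log (Real.sigmoid z) + b * Real.log (1 - Real.sigmoid z) <
      a * Real.log (Real.sigmoid (Real.log (a / b))) +
        b * Real.log (1 - Real.sigmoid (Real.log (a / b))) := by
  have hne : Real.sigmoid z ≠ a / (a + b) := by
    rw [← sigmoid_log_div ha hb]
    exact Real.sigmoid_injective.ne hz
  rw [sigmoid_log_div ha hb]
  exact mul_log_add_mul_log_one_sub_lt ha hb (Real.sigmoid_pos z) (Real.sigmoid_lt_one z) hne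


/-- For a finite set `X`, positive weights `d_E, d`, a fixed
`t : X → ℝ`, and the logistic sigmoid `σ z = 1/(1 + e^{−z})`, the GAN-style
discriminator objective
`r ↦ ∑ x, d_E x · log σ(r x − t x) + ∑ x, d x · log (1 − σ(r x − t x))`
attains its maximum uniquely at `r̂ x = t x + log (d_E x / d x)`. -/
theorem discriminator_unique_maximizer
    {X : Type*} [Fintype X]
    (dE d : X → ℝ) (hdE : ∀ x, 0 < dE x) (hd : ∀ x, 0 < d x)
    (t : X → ℝ)
    (σ : ℝ → ℝ) (hσ : σ = fun z => 1 / (1 + Real.exp (-z)))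
    (F : (X → ℝ) → ℝ)
    (hF : F = fun r => (∑ x, dE x * Real.log (σ (r x - t x)))
      + ∑ x, d x * Real.log (1 - σ (r x - t x)))
    (rhat : X → ℝ) (hrhat : rhat = fun x => t x + Real.log (dE x / d x)) :
    (∀ r : X → ℝ, F r ≤ F rhat)
    ∧ (∀ r : X → ℝ, F r = F rhat → r = rhat) := by
  have hσ' : σ = Real.sigmoid := by
    rw [hσ]
    funext z
    rw [Real.sigmoid_def, one_div]
  have hlt : ∀ r : X → ℝ, r ≠ rhat → F r < F rhat := by
    intro r hr
    obtain ⟨y, hy⟩ := Function.ne_iff.1 hr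
    have key : ∀ x, r x ≠ rhat x →
        dE x * Real.log (σ (r x - t x)) + d x * Real.log (1 - σ (r x - t x)) <
          dE x * Real.log (σ (rhat x - t x)) + d x * Real.log (1 - σ (rhat x - t x)) := by
      intro x hx
      have hrx : rhat x - t x = Real.log (dE x / d x) := by simp [hrhat]
      rw [hσ', hrx]
      refine mul_log_sigmoid_add_lt (hdE x) (hd x) fun h => hx ?_
      linarith
    simp only [hF, ← Finset.sum_add_distrib]
    refine Finset.sum_lt_sum (fun x _ => ?_) ⟨y, Finset.mem_univ y, key y hy⟩
    by_cases hx : r x = rhat x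
    · rw [hx]
    · exact (key x hx).le
  refine ⟨fun r => ?_, fun r h => ?_⟩
  · by_cases hr : r = rhat
    · rw [hr]
    · exact (hlt r hr).le
  · by_contra hr
    exact (hlt r hr).ne h
end

section
/- Let S and A be finite sets, let Ω : (A → ℝ) → ℝ be differentiable at every probability vector on A, let d_E and d be probability distributions on S × A with all entries positive, let π(a|s) := d(s,a)/Σ_{a'} d(s,a') be the policy induced by d, and let π' : S → (probability vectors on A). Define t̂(s,a) := t(a; π'(·|s)) + log( d_E(s,a)/d(s,a) ). Then Σ_{s,a} d(s,a)·t̂(s,a) − Σ_s ( Σ_a d(s,a) )·Ω(π(·|s)) = −Σ_s ( Σ_a d(s,a) )·D_Ω( π(·|s) ‖ π'(·|s) ) − Σ_{s,a} d(s,a)·log( d(s,a)/d_E(s,a) ); that is, the regularized objective decomposes into the negative expected Bregman divergence between π and π' plus the negative KL divergence KL(d ‖ d_E). -/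
/-- Averaging the linearized score `g a - ⟪q, g⟫ + c` under unnormalized weights `w` gives the total
mass times the affine function with slope `g` and value `c` at `q`, evaluated at the
normalization `p` of `w`. -/
lemma sum_mul_score_eq {A : Type*} [Fintype A] (w p q g : A → ℝ) (c : ℝ)
    (hw : ∀ a, w a = (∑ a', w a') * p a) :
    ∑ a, w a * (g a - (∑ a', q a' * g a') + c)
      = (∑ a, w a) * (c + ∑ a, g a * (p a - q a)) := by
  have hg : ∑ a, w a * g a = (∑ a, w a) * ∑ a, g a * p a := by
    rw [Finset.mul_sum]
    refine Finset.sum_congr rfl fun a _ => ?_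
    rw [hw a]
    ring
  have hq : ∑ a, g a * q a = ∑ a, q a * g a :=
    Finset.sum_congr rfl fun a _ => mul_comm _ _
  simp only [mul_add, mul_sub, Finset.sum_add_distrib, Finset.sum_sub_distrib,
    ← Finset.sum_mul, hg, hq]
  ring


/-- For finite `S`, `A`, a regularizer `Ω` differentiable at every
probability vector on `A`, strictly positive distributions `d_E, d` on `S × A`, the
policy `π(a|s) = d(s,a)/∑_{a'} d(s,a')` induced by `d`, and any policy `π'`, the
regularized objective with reward `t̂(s,a) = t(a; π'(·|s)) + log(d_E(s,a)/d(s,a))`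
decomposes as the negative expected Bregman divergence between `π` and `π'` minus
the KL divergence `KL(d ‖ d_E)`. Here `t(a; q)` and `D_Ω(p ‖ q)` are expressed via
the gradient `[∇Ω(q)](a) = fderiv ℝ Ω q (Pi.single a 1)`. -/
theorem rairl_objective_decomposition
    {S A : Type*} [Fintype S] [Fintype A] [DecidableEq A]
    (Ω : (A → ℝ) → ℝ)
    (hΩ : ∀ p : A → ℝ, (∀ a, 0 ≤ p a) → ∑ a, p a = 1 → DifferentiableAt ℝ Ω p)
    (dE d : S → A → ℝ)
    (hdE_pos : ∀ s a, 0 < dE s a) (hd_pos : ∀ s a, 0 < d s a)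
    (hdE_sum : ∑ s, ∑ a, dE s a = 1) (hd_sum : ∑ s, ∑ a, d s a = 1)
    (π : S → A → ℝ) (hπ : ∀ s a, π s a = d s a / ∑ a', d s a')
    (π' : S → A → ℝ)
    (hπ' : ∀ s, (∀ a, 0 ≤ π' s a) ∧ ∑ a, π' s a = 1) :
    (∑ s, ∑ a, d s a *
        ((fderiv ℝ Ω (π' s) (Pi.single a 1)
            - (∑ a', π' s a' * fderiv ℝ Ω (π' s) (Pi.single a' 1)) + Ω (π' s))
          + Real.log (dE s a / d s a)))
      - (∑ s, (∑ a, d s a) * Ω (π s))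
    = -(∑ s, (∑ a, d s a) *
          (Ω (π s) - Ω (π' s)
            - ∑ a, fderiv ℝ Ω (π' s) (Pi.single a 1) * (π s a - π' s a)))
      - ∑ s, ∑ a, d s a * Real.log (d s a / dE s a) := by
  have hd : ∀ s a, d s a = (∑ a', d s a') * π s a := fun s a => by
    have hpos : 0 < ∑ a', d s a' :=
      Finset.sum_pos (fun a' _ => hd_pos s a') ⟨a, Finset.mem_univ a⟩
    rw [hπ, mul_div_cancel₀ _ hpos.ne']
  have hlog : ∀ s a, Real.log (dE s a / d s a) = -Real.log (d s a / dE s a) := fun s a => by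
    rw [← Real.log_inv, inv_div]
  rw [← Finset.sum_sub_distrib, ← Finset.sum_neg_distrib, ← Finset.sum_sub_distrib]
  refine Finset.sum_congr rfl fun s _ => ?_
  have hscore := sum_mul_score_eq (d s) (π s) (π' s)
    (fun a => fderiv ℝ Ω (π' s) (Pi.single a 1)) (Ω (π' s)) (hd s)
  simp only [hlog, ← sub_eq_add_neg]
  simp_rw [mul_sub _ (_ + _) (Real.log _)]
  rw [Finset.sum_sub_distrib, hscore]
  ring
end
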